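/- Let d ≥ 2 be an integer, s ∈ (0, d/2), α ∈ (0,1) with s + α > 1. For λ > 0 define I_str(λ) := ∫_{ℝ^d} ⟨k⟩^{−d−2α} |λ e₁ − k|^{−2s} k₂² dk, where e₁, e₂ are the first two standard basis vectors of ℝ^d and k₂ = k·e₂. Then there exist constants R ≥ 1 and ρ ≥ 0 such that for all λ ≥ R, |I_str(λ) − α(d+2α)·C_{d,s,α}·λ^{−2s+2−2α}| ≤ ρ λ^{−2s}. -/

import Mathlib

open MeasureTheory

noncomputable section

/-- The Japanese bracket `⟨x⟩ = (1+|x|²)^{1/2}`. -/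
def jap {d : ℕ} (x : EuclideanSpace ℝ (Fin d)) : ℝ := Real.sqrt (1 + ‖x‖^2)

/-- The constant `C_{d,s,α}`. -/
def Cconst (d : ℕ) (s α : ℝ) : ℝ :=
  -(Real.pi ^ ((d : ℝ)/2) * Real.Gamma (s + α - 1) * Real.Gamma (((d : ℝ) - 2*s + 2)/2)
      * Real.Gamma (-α)) /
    (4 * Real.Gamma s * Real.Gamma (((d : ℝ) + 2 + 2*α)/2)
      * Real.Gamma (((d : ℝ) + 4 - 2*s - 2*α)/2))

open Set Real

theorem lintegral_rpow_mul_exp_neg_mul_Ioi {a r : ℝ} (ha : 0 < a) (hr : 0 < r) :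
    ∫⁻ t in Ioi (0 : ℝ), ENNReal.ofReal (t ^ (a - 1) * exp (-(r * t)))
      = ENNReal.ofReal (Gamma a * r ^ (-a)) := by
  have key := integral_rpow_mul_exp_neg_mul_Ioi ha hr
  have hpos : 0 < (1 / r) ^ a * Gamma a := mul_pos (by positivity) (Gamma_pos_of_pos ha)
  rw [← ofReal_integral_eq_lintegral_ofReal (.of_integral_ne_zero (by rw [key]; exact hpos.ne')),
    key, mul_comm, one_div, inv_rpow hr.le, rpow_neg hr.le]
  filter_upwards [ae_restrict_mem measurableSet_Ioi] with t (ht : 0 < t)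
  positivity

theorem integral_sq_mul_exp_neg_mul_sq {b : ℝ} (hb : 0 < b) :
    ∫ x : ℝ, exp (-b * x ^ 2) * x ^ 2 = √(π / b) / (2 * b) := by
  have h := integral_rpow_mul_exp_neg_mul_rpow (p := 2) (q := 2) two_pos (by norm_num) hb
  have h1 : ∫ x in Ioi (0 : ℝ), exp (-b * x ^ 2) * x ^ 2
      = ∫ x in Ioi (0 : ℝ), x ^ (2 : ℝ) * exp (-b * x ^ (2 : ℝ)) := by
    simp_rw [rpow_two, mul_comm]
  have h2 := integral_comp_abs (f := fun x : ℝ ↦ exp (-b * x ^ 2) * x ^ 2)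
  simp only [sq_abs] at h2
  have h3 : Gamma ((2 + 1) / 2) = √π / 2 := by
    rw [show ((2 : ℝ) + 1) / 2 = 1 / 2 + 1 by norm_num, Gamma_add_one (by norm_num),
      Gamma_one_half_eq]
    ring
  rw [h2, h1, h, h3, show -((2 : ℝ) + 1) / 2 = -(1 / 2) - 1 by norm_num, rpow_sub_one hb.ne',
    rpow_neg hb.le, ← sqrt_eq_rpow, sqrt_div pi_pos.le]
  field_simp

theorem lintegral_exp_neg_mul_sq_norm_mul_sq {ι : Type*} [Fintype ι] (j : ι) {b : ℝ}
    (hb : 0 < b) :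
    ∫⁻ k : EuclideanSpace ℝ ι, ENNReal.ofReal (exp (-b * ‖k‖ ^ 2) * k j ^ 2)
      = ENNReal.ofReal (π ^ ((Fintype.card ι : ℝ) / 2) / 2
          * b ^ (-(Fintype.card ι : ℝ) / 2 - 1)) := by
  classical
  set f : ι → ℝ → ℝ := fun i x ↦ exp (-b * x ^ 2) * if i = j then x ^ 2 else 1 with hf
  have hfj : ∫ x, f j x = √(π / b) / (2 * b) := by
    simpa [hf] using integral_sq_mul_exp_neg_mul_sq hb
  have hfi : ∀ i, i ≠ j → ∫ x, f i x = √(π / b) := by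
    intro i hi
    simpa [hf, hi] using integral_gaussian b
  have hfint : ∀ i, Integrable (f i) := by
    intro i
    refine .of_integral_ne_zero ?_
    by_cases hi : i = j
    · subst hi
      rw [hfj]
      positivity
    · rw [hfi i hi]
      positivity
  have hprod : ∀ x : ι → ℝ,
      exp (-b * ‖(WithLp.toLp 2 x : EuclideanSpace ℝ ι)‖ ^ 2) * x j ^ 2 = ∏ i, f i (x i) := by
    intro x
    simp only [hf]
    rw [Finset.prod_mul_distrib, Finset.prod_ite_eq' Finset.univ j, if_pos (Finset.mem_univ j),
      ← exp_sum, EuclideanSpace.norm_sq_eq, Finset.mul_sum]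
    simp
  have hval : ∏ i, ∫ x, f i x
      = π ^ ((Fintype.card ι : ℝ) / 2) / 2 * b ^ (-(Fintype.card ι : ℝ) / 2 - 1) := by
    have hsplit : ∀ i, ∫ x, f i x = √(π / b) * if i = j then 1 / (2 * b) else 1 := by
      intro i
      by_cases hi : i = j
      · subst hi
        rw [hfj, if_pos rfl]
        ring
      · rw [hfi i hi, if_neg hi, mul_one]
    simp_rw [hsplit, Finset.prod_mul_distrib, Finset.prod_const, Finset.card_univ]
    rw [Finset.prod_ite_eq' Finset.univ j, if_pos (Finset.mem_univ j), sqrt_eq_rpow, ← rpow_natCast,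
      ← rpow_mul (by positivity), div_rpow pi_pos.le hb.le, rpow_sub_one hb.ne',
      neg_div, rpow_neg hb.le, one_div_mul_eq_div]
    field_simp
  rw [← (PiLp.volume_preserving_toLp ι).lintegral_comp_emb
    (MeasurableEquiv.toLp 2 (ι → ℝ)).measurableEmbedding]
  simp_rw [hprod]
  have hI : Integrable (fun x : ι → ℝ ↦ ∏ i, f i (x i)) := Integrable.fintype_prod hfint
  rw [← ofReal_integral_eq_lintegral_ofReal hI
    (.of_forall fun x ↦ by
      change 0 ≤ ∏ i, f i (x i)
      rw [← hprod]
      positivity), ← hval, integral_fintype_prod_volume_eq_prod]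

theorem lintegral_exp_neg_two_centers_mul_sq {ι : Type*} [Fintype ι] (j : ι)
    {v : EuclideanSpace ℝ ι} (hv : v j = 0) {t u : ℝ} (ht : 0 < t) (hu : 0 < u) :
    ∫⁻ k : EuclideanSpace ℝ ι,
        ENNReal.ofReal (exp (-(t * ‖k‖ ^ 2)) * exp (-(u * ‖v - k‖ ^ 2)) * k j ^ 2)
      = ENNReal.ofReal (π ^ ((Fintype.card ι : ℝ) / 2) / 2
          * ((t + u) ^ (-(Fintype.card ι : ℝ) / 2 - 1)
            * exp (-(‖v‖ ^ 2 * (t * u / (t + u)))))) := by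
  have htu : 0 < t + u := add_pos ht hu
  rw [← lintegral_add_right_eq_self _ ((u / (t + u)) • v)]
  have h : ∀ k : EuclideanSpace ℝ ι,
      ENNReal.ofReal (exp (-(t * ‖k + (u / (t + u)) • v‖ ^ 2))
        * exp (-(u * ‖v - (k + (u / (t + u)) • v)‖ ^ 2)) * (k + (u / (t + u)) • v) j ^ 2)
      = ENNReal.ofReal (exp (-(‖v‖ ^ 2 * (t * u / (t + u)))))
        * ENNReal.ofReal (exp (-(t + u) * ‖k‖ ^ 2) * k j ^ 2) := by
    intro k
    rw [← ENNReal.ofReal_mul (exp_pos _).le, ← mul_assoc, ← exp_add, ← exp_add]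
    have e1 : v - (k + (u / (t + u)) • v) = (t / (t + u)) • v - k := by
      rw [show t / (t + u) = 1 - u / (t + u) by field_simp; ring]
      module
    have e2 : (k + (u / (t + u)) • v) j = k j := by simp [hv]
    rw [e1, e2, norm_add_sq_real, norm_sub_sq_real, inner_smul_left, inner_smul_right, norm_smul,
      norm_smul, real_inner_comm, norm_of_nonneg (by positivity : 0 ≤ u / (t + u)),
      norm_of_nonneg (by positivity : 0 ≤ t / (t + u))]
    congr 3
    simp only [conj_trivial]
    field_simp
    ring
  simp_rw [h]
  rw [lintegral_const_mul' _ _ ENNReal.ofReal_ne_top, lintegral_exp_neg_mul_sq_norm_mul_sq j htu,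
    ← ENNReal.ofReal_mul (exp_pos _).le]
  congr 1
  ring

theorem lintegral_Ioi_eq_lintegral_Ioo_div_one_sub {t : ℝ} (ht : 0 < t) (g : ℝ → ENNReal) :
    ∫⁻ u in Ioi (0 : ℝ), g u
      = ∫⁻ w in Ioo (0 : ℝ) 1, ENNReal.ofReal (t / (1 - w) ^ 2) * g (t * w / (1 - w)) := by
  have himg : (fun w : ℝ ↦ t * w / (1 - w)) '' Ioo 0 1 = Ioi 0 := by
    ext u
    constructor
    · rintro ⟨w, ⟨h0, h1⟩, rfl⟩
      have : 0 < 1 - w := by linarith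
      exact mem_Ioi.2 (by positivity)
    · intro (hu : 0 < u)
      refine ⟨u / (t + u), ⟨by positivity, (div_lt_one (by positivity)).2 (by linarith)⟩, ?_⟩
      have : 1 - u / (t + u) = t / (t + u) := by field_simp; ring
      simp only [this]
      field_simp
  have hderiv : ∀ w ∈ Ioo (0 : ℝ) 1,
      HasDerivWithinAt (fun w : ℝ ↦ t * w / (1 - w)) (t / (1 - w) ^ 2) (Ioo 0 1) w := by
    rintro w ⟨h0, h1⟩
    have h : (1 : ℝ) - w ≠ 0 := by linarith
    have := (((hasDerivAt_id w).const_mul t).div ((hasDerivAt_id w).const_sub 1) h)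
    refine (this.congr_deriv ?_).hasDerivWithinAt
    simp only [id]
    congr 1
    ring
  have hinj : InjOn (fun w : ℝ ↦ t * w / (1 - w)) (Ioo 0 1) := by
    rintro w ⟨h0, h1⟩ w' ⟨h0', h1'⟩ h
    have e : (1 : ℝ) - w ≠ 0 := by linarith
    have e' : (1 : ℝ) - w' ≠ 0 := by linarith
    simp only at h
    field_simp at h
    linarith
  rw [← himg, lintegral_image_eq_lintegral_abs_deriv_mul measurableSet_Ioo hderiv hinj]
  refine setLIntegral_congr_fun measurableSet_Ioo fun w _ ↦ ?_
  simp only [abs_of_nonneg (by positivity : 0 ≤ t / (1 - w) ^ 2)]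

/-- The truncated Laplace transform `∫_0^1 w^(s-1) (1-w)^(m-s) exp(-x w) dw`. -/
def betaLaplace (s m x : ℝ) : ENNReal :=
  ∫⁻ w in Ioo (0 : ℝ) 1, ENNReal.ofReal (w ^ (s - 1) * (1 - w) ^ (m - s) * exp (-(x * w)))

theorem measurable_betaLaplace (s m : ℝ) : Measurable (betaLaplace s m) :=
  Measurable.lintegral_prod_right (by fun_prop)

theorem lintegral_rpow_mul_add_rpow_mul_exp {s m c t : ℝ} (ht : 0 < t) :
    ∫⁻ u in Ioi (0 : ℝ),
        ENNReal.ofReal (u ^ (s - 1) * ((t + u) ^ (-m - 1) * exp (-(c * (t * u / (t + u))))))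
      = ENNReal.ofReal (t ^ (s - m - 1)) * betaLaplace s m (c * t) := by
  rw [lintegral_Ioi_eq_lintegral_Ioo_div_one_sub ht, betaLaplace,
    ← lintegral_const_mul' _ _ ENNReal.ofReal_ne_top]
  refine setLIntegral_congr_fun measurableSet_Ioo fun w ⟨h0, h1⟩ ↦ ?_
  have h : 0 < 1 - w := by linarith
  have e : t + t * w / (1 - w) = t / (1 - w) := by field_simp; ring
  rw [← ENNReal.ofReal_mul (by positivity), ← ENNReal.ofReal_mul (by positivity), e]
  congr 1
  have e2 : c * (t * (t * w / (1 - w)) / (t / (1 - w))) = c * t * w := by field_simp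
  have e3 : (1 - w) ^ (m - s)
      = ((1 - w) ^ 2)⁻¹ * ((1 - w) ^ (s - 1))⁻¹ * ((1 - w) ^ (-m - 1))⁻¹ := by
    rw [← rpow_natCast, ← rpow_neg h.le, ← rpow_neg h.le, ← rpow_neg h.le, ← rpow_add h,
      ← rpow_add h]
    congr 1
    push_cast
    ring
  rw [e2, div_rpow (by positivity) h.le, div_rpow ht.le h.le, mul_rpow ht.le h0.le,
    show s - m - 1 = 1 + (s - 1) + (-m - 1) by ring, rpow_add ht, rpow_add ht, rpow_one, e3]
  ring

theorem lintegral_rpow_mul_one_sub_rpow {a b : ℝ} (ha : 0 < a) (hb : 0 < b) :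
    ∫⁻ w in Ioo (0 : ℝ) 1, ENNReal.ofReal (w ^ (a - 1) * (1 - w) ^ (b - 1))
      = ENNReal.ofReal (ProbabilityTheory.beta a b) := by
  have hB := ProbabilityTheory.beta_pos ha hb
  have h := ProbabilityTheory.lintegral_betaPDF_eq_one ha hb
  rw [ProbabilityTheory.lintegral_betaPDF] at h
  simp_rw [mul_assoc, ENNReal.ofReal_mul (by positivity : 0 ≤ 1 / ProbabilityTheory.beta a b)] at h
  rw [lintegral_const_mul' _ _ ENNReal.ofReal_ne_top] at h
  rw [← mul_one (ENNReal.ofReal (ProbabilityTheory.beta a b)), ← h, ← mul_assoc,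
    ← ENNReal.ofReal_mul hB.le, mul_one_div_cancel hB.ne', ENNReal.ofReal_one, one_mul]

theorem lintegral_rpow_mul_betaLaplace {s m β c : ℝ} (hβ : 0 < β) (hβs : β < s)
    (hsm : s < m + 1) (hc : 0 < c) :
    ∫⁻ t in Ioi (0 : ℝ), ENNReal.ofReal (t ^ (β - 1)) * betaLaplace s m (c * t)
      = ENNReal.ofReal (Gamma β * c ^ (-β) * ProbabilityTheory.beta (s - β) (m - s + 1)) := by
  simp_rw [betaLaplace, ← lintegral_const_mul' _ _ ENNReal.ofReal_ne_top]
  rw [lintegral_lintegral_swap (by fun_prop), ENNReal.ofReal_mul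
    (mul_nonneg (Gamma_pos_of_pos hβ).le (by positivity)), ← lintegral_rpow_mul_one_sub_rpow
      (by linarith) (by linarith), ← lintegral_const_mul' _ _ ENNReal.ofReal_ne_top]
  refine setLIntegral_congr_fun measurableSet_Ioo fun w ⟨h0, h1⟩ ↦ ?_
  have h : 0 < 1 - w := by linarith
  have e : ∀ t ∈ Ioi (0 : ℝ), ENNReal.ofReal (t ^ (β - 1))
        * ENNReal.ofReal (w ^ (s - 1) * (1 - w) ^ (m - s) * exp (-(c * t * w)))
      = ENNReal.ofReal (w ^ (s - 1) * (1 - w) ^ (m - s))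
        * ENNReal.ofReal (t ^ (β - 1) * exp (-(c * w * t))) := by
    intro t (ht : 0 < t)
    rw [← ENNReal.ofReal_mul (by positivity), ← ENNReal.ofReal_mul (by positivity),
      show c * t * w = c * w * t by ring]
    congr 1
    ring
  rw [setLIntegral_congr_fun measurableSet_Ioi e, lintegral_const_mul' _ _ ENNReal.ofReal_ne_top,
    lintegral_rpow_mul_exp_neg_mul_Ioi hβ (mul_pos hc h0), ← ENNReal.ofReal_mul (by positivity),
    ← ENNReal.ofReal_mul (mul_nonneg (Gamma_pos_of_pos hβ).le (by positivity)),
    mul_rpow hc.le h0.le, show s - β - 1 = s - 1 + -β by ring, rpow_add h0, add_sub_cancel_right]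
  congr 1
  ring

theorem betaLaplace_le {s m x : ℝ} (hs : 0 < s) (hsm : s ≤ m) (hx : 0 < x) :
    betaLaplace s m x ≤ ENNReal.ofReal (Gamma s * x ^ (-s)) := by
  rw [← lintegral_rpow_mul_exp_neg_mul_Ioi hs hx]
  refine (setLIntegral_mono' measurableSet_Ioo fun w ⟨h0, h1⟩ ↦ ENNReal.ofReal_le_ofReal ?_).trans
    (lintegral_mono_set Ioo_subset_Ioi_self)
  refine mul_le_mul_of_nonneg_right (mul_le_of_le_one_right (by positivity) ?_) (exp_pos _).le
  exact rpow_le_one (by linarith) (by linarith) (by linarith)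

theorem integrableOn_one_sub_exp_neg_mul_rpow {α : ℝ} (hα0 : 0 < α) (hα1 : α < 1) :
    IntegrableOn (fun t : ℝ ↦ (1 - exp (-t)) * t ^ (α - 2)) (Ioi 0) := by
  rw [← Ioc_union_Ioi_eq_Ioi zero_le_one, integrableOn_union]
  constructor
  · have h : IntegrableOn (fun t : ℝ ↦ t ^ (α - 1)) (Ioc 0 1) :=
      (intervalIntegrable_iff_integrableOn_Ioc_of_le zero_le_one).1
        (intervalIntegral.intervalIntegrable_rpow' (by linarith))
    refine Integrable.mono' h (by fun_prop) ?_
    filter_upwards [ae_restrict_mem measurableSet_Ioc] with t ht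
    have h1 := add_one_le_exp (-t)
    have h2 : exp (-t) ≤ 1 := exp_le_one_iff.2 (by linarith [ht.1])
    rw [norm_of_nonneg (mul_nonneg (by linarith) (rpow_nonneg ht.1.le _)),
      show α - 1 = 1 + (α - 2) by ring, rpow_add ht.1, rpow_one]
    exact mul_le_mul_of_nonneg_right (by linarith) (rpow_nonneg ht.1.le _)
  · have h : IntegrableOn (fun t : ℝ ↦ t ^ (α - 2)) (Ioi 1) :=
      integrableOn_Ioi_rpow_of_lt (by linarith) one_pos
    refine Integrable.mono' h (by fun_prop) ?_
    filter_upwards [ae_restrict_mem measurableSet_Ioi] with t (ht : 1 < t)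
    have h2 : exp (-t) ≤ 1 := exp_le_one_iff.2 (by linarith)
    have h3 : 0 ≤ t ^ (α - 2) := by positivity
    rw [norm_of_nonneg (mul_nonneg (by linarith) h3)]
    exact mul_le_of_le_one_left h3 (by linarith [exp_pos (-t)])

theorem lintegral_one_sub_exp_neg_mul_betaLaplace_le {s m α c : ℝ} (hs : 0 < s) (hsm : s ≤ m)
    (hα0 : 0 < α) (hα1 : α < 1) (hc : 0 < c) :
    ∫⁻ t in Ioi (0 : ℝ), ENNReal.ofReal ((1 - exp (-t)) * t ^ (s + α - 2))
        * betaLaplace s m (c * t)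
      ≤ ENNReal.ofReal (Gamma s * c ^ (-s) * ∫ t in Ioi (0 : ℝ), (1 - exp (-t)) * t ^ (α - 2)) := by
  have hnn : ∀ t : ℝ, 0 < t → 0 ≤ 1 - exp (-t) := fun t ht ↦
    sub_nonneg.2 (exp_le_one_iff.2 (by linarith))
  have hG : 0 ≤ Gamma s * c ^ (-s) := mul_nonneg (Gamma_pos_of_pos hs).le (by positivity)
  rw [ENNReal.ofReal_mul hG, ofReal_integral_eq_lintegral_ofReal
    (integrableOn_one_sub_exp_neg_mul_rpow hα0 hα1), ← lintegral_const_mul' _ _ ENNReal.ofReal_ne_top]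
  · refine setLIntegral_mono' measurableSet_Ioi fun t (ht : 0 < t) ↦ ?_
    refine (mul_le_mul_right (betaLaplace_le hs hsm (mul_pos hc ht)) _).trans_eq ?_
    rw [← ENNReal.ofReal_mul (mul_nonneg (hnn t ht) (by positivity)), ← ENNReal.ofReal_mul hG,
      mul_rpow hc.le ht.le, show α - 2 = s + α - 2 + -s by ring, rpow_add ht]
    congr 1
    ring
  · filter_upwards [ae_restrict_mem measurableSet_Ioi] with t (ht : 0 < t)
    exact mul_nonneg (hnn t ht) (by positivity)

theorem ofReal_rpow_mul_rpow_mul_sq_eq {ι : Type*} [Fintype ι] (j : ι)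
    {v : EuclideanSpace ℝ ι} (hv : v j = 0) {a s : ℝ} (ha : 0 < a) (hs : 0 < s)
    (k : EuclideanSpace ℝ ι) :
    ENNReal.ofReal ((1 + ‖k‖ ^ 2) ^ (-a) * (‖v - k‖ ^ 2) ^ (-s) * k j ^ 2)
      = ENNReal.ofReal (1 / (Gamma a * Gamma s)) * ∫⁻ t in Ioi (0 : ℝ), ∫⁻ u in Ioi (0 : ℝ),
          ENNReal.ofReal (t ^ (a - 1) * exp (-((1 + ‖k‖ ^ 2) * t))
            * (u ^ (s - 1) * exp (-(‖v - k‖ ^ 2 * u))) * k j ^ 2) := by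
  by_cases hk : v = k
  · simp [← hk, hv]
  have hpos : 0 < ‖v - k‖ ^ 2 := pow_pos (norm_pos_iff.2 (sub_ne_zero.2 hk)) 2
  have hΓa := Gamma_pos_of_pos ha
  have hΓs := Gamma_pos_of_pos hs
  have hinner : ∀ t ∈ Ioi (0 : ℝ), ∫⁻ u in Ioi (0 : ℝ),
      ENNReal.ofReal (t ^ (a - 1) * exp (-((1 + ‖k‖ ^ 2) * t))
        * (u ^ (s - 1) * exp (-(‖v - k‖ ^ 2 * u))) * k j ^ 2)
      = ENNReal.ofReal (Gamma s * (‖v - k‖ ^ 2) ^ (-s) * k j ^ 2)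
        * ENNReal.ofReal (t ^ (a - 1) * exp (-((1 + ‖k‖ ^ 2) * t))) := by
    intro t (ht : 0 < t)
    have h : ∀ u : ℝ, ENNReal.ofReal (t ^ (a - 1) * exp (-((1 + ‖k‖ ^ 2) * t))
          * (u ^ (s - 1) * exp (-(‖v - k‖ ^ 2 * u))) * k j ^ 2)
        = ENNReal.ofReal (t ^ (a - 1) * exp (-((1 + ‖k‖ ^ 2) * t)) * k j ^ 2)
          * ENNReal.ofReal (u ^ (s - 1) * exp (-(‖v - k‖ ^ 2 * u))) := by
      intro u
      rw [← ENNReal.ofReal_mul (by positivity)]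
      congr 1
      ring
    simp_rw [h]
    rw [lintegral_const_mul' _ _ ENNReal.ofReal_ne_top,
      lintegral_rpow_mul_exp_neg_mul_Ioi hs hpos, ← ENNReal.ofReal_mul (by positivity),
      ← ENNReal.ofReal_mul (by positivity)]
    congr 1
    ring
  rw [setLIntegral_congr_fun measurableSet_Ioi hinner,
    lintegral_const_mul' _ _ ENNReal.ofReal_ne_top,
    lintegral_rpow_mul_exp_neg_mul_Ioi ha (by positivity), ← ENNReal.ofReal_mul (by positivity),
    ← ENNReal.ofReal_mul (by positivity)]
  congr 1
  field_simp

theorem lintegral_rpow_mul_rpow_mul_sq {ι : Type*} [Fintype ι] (j : ι)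
    {v : EuclideanSpace ℝ ι} (hv : v j = 0) {s α : ℝ} (hs : 0 < s) (hα : 0 < α) :
    ∫⁻ k : EuclideanSpace ℝ ι, ENNReal.ofReal ((1 + ‖k‖ ^ 2) ^ (-((Fintype.card ι : ℝ) / 2 + α))
        * (‖v - k‖ ^ 2) ^ (-s) * k j ^ 2)
      = ENNReal.ofReal (π ^ ((Fintype.card ι : ℝ) / 2)
            / (2 * (Gamma ((Fintype.card ι : ℝ) / 2 + α) * Gamma s)))
        * ∫⁻ t in Ioi (0 : ℝ), ENNReal.ofReal (exp (-t) * t ^ (s + α - 2))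
            * betaLaplace s ((Fintype.card ι : ℝ) / 2) (‖v‖ ^ 2 * t) := by
  set m : ℝ := (Fintype.card ι : ℝ) / 2 with hm
  have hm0 : 0 ≤ m := by positivity
  have ha : 0 < m + α := by positivity
  have hΓa := Gamma_pos_of_pos ha
  have hΓs := Gamma_pos_of_pos hs
  simp_rw [ofReal_rpow_mul_rpow_mul_sq_eq j hv ha hs]
  rw [lintegral_const_mul' _ _ ENNReal.ofReal_ne_top,
    lintegral_lintegral_swap (Measurable.aemeasurable
      (Measurable.lintegral_prod_right (by fun_prop)))]
  have hinner : ∀ t ∈ Ioi (0 : ℝ), ∫⁻ k : EuclideanSpace ℝ ι, ∫⁻ u in Ioi (0 : ℝ),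
      ENNReal.ofReal (t ^ (m + α - 1) * exp (-((1 + ‖k‖ ^ 2) * t))
        * (u ^ (s - 1) * exp (-(‖v - k‖ ^ 2 * u))) * k j ^ 2)
      = ENNReal.ofReal (π ^ m / 2) * (ENNReal.ofReal (exp (-t) * t ^ (s + α - 2))
          * betaLaplace s m (‖v‖ ^ 2 * t)) := by
    intro t (ht : 0 < t)
    rw [lintegral_lintegral_swap (by fun_prop)]
    have hgauss : ∀ u ∈ Ioi (0 : ℝ), ∫⁻ k : EuclideanSpace ℝ ι,
        ENNReal.ofReal (t ^ (m + α - 1) * exp (-((1 + ‖k‖ ^ 2) * t))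
          * (u ^ (s - 1) * exp (-(‖v - k‖ ^ 2 * u))) * k j ^ 2)
        = ENNReal.ofReal (π ^ m / 2 * (exp (-t) * t ^ (m + α - 1)))
          * ENNReal.ofReal (u ^ (s - 1)
            * ((t + u) ^ (-m - 1) * exp (-(‖v‖ ^ 2 * (t * u / (t + u)))))) := by
      intro u (hu : 0 < u)
      have h : ∀ k : EuclideanSpace ℝ ι,
          ENNReal.ofReal (t ^ (m + α - 1) * exp (-((1 + ‖k‖ ^ 2) * t))
            * (u ^ (s - 1) * exp (-(‖v - k‖ ^ 2 * u))) * k j ^ 2)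
          = ENNReal.ofReal (t ^ (m + α - 1) * exp (-t) * u ^ (s - 1))
            * ENNReal.ofReal (exp (-(t * ‖k‖ ^ 2)) * exp (-(u * ‖v - k‖ ^ 2)) * k j ^ 2) := by
        intro k
        rw [← ENNReal.ofReal_mul (by positivity),
          show -((1 + ‖k‖ ^ 2) * t) = -t + -(t * ‖k‖ ^ 2) by ring, exp_add,
          mul_comm (‖v - k‖ ^ 2) u]
        congr 1
        ring
      simp_rw [h]
      rw [lintegral_const_mul' _ _ ENNReal.ofReal_ne_top,
        lintegral_exp_neg_two_centers_mul_sq j hv ht hu, ← ENNReal.ofReal_mul (by positivity),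
        ← ENNReal.ofReal_mul (by positivity), neg_div, ← hm]
      congr 1
      ring
    rw [setLIntegral_congr_fun measurableSet_Ioi hgauss,
      lintegral_const_mul' _ _ ENNReal.ofReal_ne_top, lintegral_rpow_mul_add_rpow_mul_exp ht,
      ← mul_assoc (ENNReal.ofReal _) (ENNReal.ofReal _) (betaLaplace _ _ _),
      ← ENNReal.ofReal_mul (by positivity), ← mul_assoc (ENNReal.ofReal (π ^ m / 2)),
      ← ENNReal.ofReal_mul (by positivity),
      show s + α - 2 = m + α - 1 + (s - m - 1) by ring, rpow_add ht]
    congr 2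
    ring
  rw [setLIntegral_congr_fun measurableSet_Ioi hinner,
    lintegral_const_mul' _ _ ENNReal.ofReal_ne_top, ← mul_assoc,
    ← ENNReal.ofReal_mul (by positivity)]
  congr 2
  field_simp

theorem abs_lintegral_exp_neg_mul_betaLaplace_sub_le {s m α c : ℝ} (hs : 0 < s) (hsm : s ≤ m)
    (hα0 : 0 < α) (hα1 : α < 1) (hsα : 1 < s + α) (hc : 0 < c) :
    |(∫⁻ t in Ioi (0 : ℝ), ENNReal.ofReal (exp (-t) * t ^ (s + α - 2))
        * betaLaplace s m (c * t)).toReal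
      - Gamma (s + α - 1) * c ^ (-(s + α - 1)) * ProbabilityTheory.beta (1 - α) (m - s + 1)|
      ≤ Gamma s * c ^ (-s) * ∫ t in Ioi (0 : ℝ), (1 - exp (-t)) * t ^ (α - 2) := by
  have hM := lintegral_rpow_mul_betaLaplace (s := s) (m := m) (β := s + α - 1) (by linarith)
    (by linarith) (by linarith) hc
  have hD := lintegral_one_sub_exp_neg_mul_betaLaplace_le hs hsm hα0 hα1 hc
  rw [show s - (s + α - 1) = 1 - α by ring, show s + α - 1 - 1 = s + α - 2 by ring] at hM
  have hsplit : ∫⁻ t in Ioi (0 : ℝ), ENNReal.ofReal (t ^ (s + α - 2)) * betaLaplace s m (c * t)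
      = (∫⁻ t in Ioi (0 : ℝ), ENNReal.ofReal (exp (-t) * t ^ (s + α - 2))
          * betaLaplace s m (c * t))
        + ∫⁻ t in Ioi (0 : ℝ), ENNReal.ofReal ((1 - exp (-t)) * t ^ (s + α - 2))
          * betaLaplace s m (c * t) := by
    have hmeas := measurable_betaLaplace s m
    rw [← lintegral_add_left (by fun_prop)]
    refine setLIntegral_congr_fun measurableSet_Ioi fun t (ht : 0 < t) ↦ ?_
    have h1 : exp (-t) ≤ 1 := exp_le_one_iff.2 (by linarith)
    rw [← add_mul, ← ENNReal.ofReal_add (by positivity)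
      (mul_nonneg (sub_nonneg.2 h1) (by positivity))]
    ring_nf
  have hMnn : 0 ≤ Gamma (s + α - 1) * c ^ (-(s + α - 1))
      * ProbabilityTheory.beta (1 - α) (m - s + 1) :=
    mul_nonneg (mul_nonneg (Gamma_pos_of_pos (by linarith)).le (by positivity))
      (ProbabilityTheory.beta_pos (by linarith) (by linarith)).le
  have hJ : 0 ≤ ∫ t in Ioi (0 : ℝ), (1 - exp (-t)) * t ^ (α - 2) :=
    setIntegral_nonneg measurableSet_Ioi fun t (ht : 0 < t) ↦
      mul_nonneg (sub_nonneg.2 (exp_le_one_iff.2 (by linarith))) (by positivity)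
  have hDnn : 0 ≤ Gamma s * c ^ (-s) * ∫ t in Ioi (0 : ℝ), (1 - exp (-t)) * t ^ (α - 2) :=
    mul_nonneg (mul_nonneg (Gamma_pos_of_pos hs).le (by positivity)) hJ
  rw [hsplit] at hM
  have hfin := hM.trans_ne ENNReal.ofReal_ne_top
  rw [ENNReal.add_ne_top] at hfin
  rw [← ENNReal.toReal_ofReal hMnn, ← hM, ENNReal.toReal_add hfin.1 hfin.2, sub_add_cancel_left,
    abs_neg, abs_of_nonneg ENNReal.toReal_nonneg]
  exact ENNReal.toReal_le_of_le_ofReal hDnn hD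

theorem mul_Cconst_eq (d : ℕ) {s α : ℝ} (hα0 : 0 < α) :
    α * ((d : ℝ) + 2 * α) * Cconst d s α
      = π ^ ((d : ℝ) / 2) / (2 * (Gamma ((d : ℝ) / 2 + α) * Gamma s))
        * (Gamma (s + α - 1) * ProbabilityTheory.beta (1 - α) ((d : ℝ) / 2 - s + 1)) := by
  have h0 : (d : ℝ) / 2 + α ≠ 0 := by positivity
  have h1 : Gamma (1 - α) = -α * Gamma (-α) := by
    rw [← Gamma_add_one (neg_ne_zero.2 hα0.ne'), neg_add_eq_sub]
  have h2 : Gamma (((d : ℝ) + 2 + 2 * α) / 2)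
      = ((d : ℝ) / 2 + α) * Gamma ((d : ℝ) / 2 + α) := by
    rw [← Gamma_add_one h0]
    ring_nf
  rw [Cconst, ProbabilityTheory.beta, h1, h2,
    show ((d : ℝ) - 2 * s + 2) / 2 = (d : ℝ) / 2 - s + 1 by ring,
    show ((d : ℝ) + 4 - 2 * s - 2 * α) / 2 = 1 - α + ((d : ℝ) / 2 - s + 1) by ring,
    show α * ((d : ℝ) + 2 * α) = 2 * α * ((d : ℝ) / 2 + α) by ring]
  field_simp
  ring

/-- Asymptotics of the stretching integral
`I_str(λ) = ∫ ⟨k⟩^{−d−2α} |λe₁ − k|^{−2s} k₂² dk`: there are `R ≥ 1`, `ρ ≥ 0` with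
`|I_str(λ) − α(d+2α) C_{d,s,α} λ^{−2s+2−2α}| ≤ ρ λ^{−2s}` for all `λ ≥ R`. -/
theorem stmt6 (d : ℕ) (hd : 2 ≤ d) (s α : ℝ) (hs0 : 0 < s) (hsd : s < (d : ℝ)/2)
    (hα0 : 0 < α) (hα1 : α < 1) (hsα : 1 < s + α) :
    ∃ R ρ : ℝ, 1 ≤ R ∧ 0 ≤ ρ ∧ ∀ lam : ℝ, R ≤ lam →
      |(∫ k : EuclideanSpace ℝ (Fin d),
          jap k ^ (-(d : ℝ) - 2*α)
            * ‖lam • EuclideanSpace.single (⟨0, by omega⟩ : Fin d) (1:ℝ) - k‖ ^ (-(2*s))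
            * (k (⟨1, by omega⟩ : Fin d))^2)
          - α*((d : ℝ) + 2*α) * Cconst d s α * lam ^ (-(2*s) + 2 - 2*α)|
        ≤ ρ * lam ^ (-(2*s)) := by
  have hΓs := Gamma_pos_of_pos hs0
  have hΓa := Gamma_pos_of_pos (show 0 < (d : ℝ) / 2 + α by positivity)
  have hJ : 0 ≤ ∫ t in Ioi (0 : ℝ), (1 - exp (-t)) * t ^ (α - 2) :=
    setIntegral_nonneg measurableSet_Ioi fun t (ht : 0 < t) ↦
      mul_nonneg (sub_nonneg.2 (exp_le_one_iff.2 (by linarith))) (by positivity)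
  set C : ℝ := π ^ ((d : ℝ) / 2) / (2 * (Gamma ((d : ℝ) / 2 + α) * Gamma s)) with hC
  have hC0 : 0 ≤ C := by positivity
  refine ⟨1, C * (Gamma s * ∫ t in Ioi (0 : ℝ), (1 - exp (-t)) * t ^ (α - 2)), le_rfl,
    by positivity, fun lam hlam ↦ ?_⟩
  have hlam0 : 0 < lam := by linarith
  set i₀ : Fin d := ⟨0, by omega⟩
  set j : Fin d := ⟨1, by omega⟩
  set v : EuclideanSpace ℝ (Fin d) := lam • EuclideanSpace.single i₀ (1 : ℝ) with hv
  have hvj : v j = 0 := by simp [hv, i₀, j]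
  have hvn : ‖v‖ = lam := by simp [hv, norm_smul, abs_of_pos hlam0]
  have hfun : ∀ k : EuclideanSpace ℝ (Fin d),
      jap k ^ (-(d : ℝ) - 2 * α) * ‖v - k‖ ^ (-(2 * s)) * k j ^ 2
        = (1 + ‖k‖ ^ 2) ^ (-((d : ℝ) / 2 + α)) * (‖v - k‖ ^ 2) ^ (-s) * k j ^ 2 := by
    intro k
    rw [jap, sqrt_eq_rpow, ← rpow_mul (by positivity), ← rpow_natCast ‖v - k‖ 2,
      ← rpow_mul (norm_nonneg _)]
    ring_nf
  have hlint := lintegral_rpow_mul_rpow_mul_sq j hvj hs0 hα0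
  rw [Fintype.card_fin, hvn, ← hC] at hlint
  simp_rw [hfun]
  rw [integral_eq_lintegral_of_nonneg_ae (.of_forall fun k ↦ by positivity)
    (by fun_prop), hlint, ENNReal.toReal_mul, ENNReal.toReal_ofReal hC0, mul_Cconst_eq d hα0, ← hC]
  have hbound := abs_lintegral_exp_neg_mul_betaLaplace_sub_le hs0 hsd.le hα0 hα1 hsα
    (pow_pos hlam0 2)
  rw [← rpow_natCast lam 2, ← rpow_mul hlam0.le, ← rpow_mul hlam0.le] at hbound
  push_cast at hbound
  rw [show 2 * -(s + α - 1) = -(2 * s) + 2 - 2 * α by ring,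
    show 2 * -s = -(2 * s) by ring] at hbound
  rw [rpow_two] at hbound
  calc _ = C * _ := by rw [mul_assoc C, ← mul_sub, abs_mul, abs_of_nonneg hC0, mul_right_comm]
    _ ≤ C * _ := mul_le_mul_of_nonneg_left hbound hC0
    _ = _ := by ring
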